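/- Fix positive integers M, N, K, L, user nominal coordinates a, b : Fin K → Fin L → Fin N → ℝ, altitude h > 0, a constant A > 0, displacement bounds D : Fin M → Fin N → ℝ, and linearization points c̃ : Fin K → Fin L → Fin M → Fin N → ℝ with c̃ k l m n > 0 for all indices. Then the set of tuples (x, y, c, R) ∈ (Fin M → Fin N → ℝ) × (Fin M → Fin N → ℝ) × (Fin K → Fin L → Fin M → Fin N → ℝ) × ℝ satisfying: (i) for all k,l: (1/(N·L)) · Σ_n Real.logb 2 (1 + A · Σ_m c k l m n) ≥ R together with c k l m n ≥ 0 for all indices; (ii) for all k,l,m,n: (x m n − a k l n)² + (y m n − b k l n)² + h² ≤ 1/(c̃ k l m n) − (c k l m n − c̃ k l m n)/(c̃ k l m n)²; and (iii) for all m and all n with n+1 < N: (x m (n+1) − x m n)² + (y m (n+1) − y m n)² ≤ (D m n)², is a convex subset of the real vector space (Fin M → Fin N → ℝ) × (Fin M → Fin N → ℝ) × (Fin K → Fin L → Fin M → Fin N → ℝ) × ℝ. -/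

import Mathlib

theorem aux_sq (s t u v : ℝ) (hs : 0 ≤ s) (ht : 0 ≤ t) (hst : s + t = 1) :
    (s * u + t * v) ^ 2 ≤ s * u ^ 2 + t * v ^ 2 := by
  have h1 : t = 1 - s := by linarith
  subst h1
  nlinarith [mul_nonneg (mul_nonneg hs ht) (sq_nonneg (u - v))]

theorem aux_log (s t u v : ℝ) (hs : 0 ≤ s) (ht : 0 ≤ t) (hst : s + t = 1)
    (hu : 0 < u) (hv : 0 < v) :
    s * Real.logb 2 u + t * Real.logb 2 v ≤ Real.logb 2 (s * u + t * v) := by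
  have h1 := strictConcaveOn_log_Ioi.concaveOn.2 (Set.mem_Ioi.2 hu) (Set.mem_Ioi.2 hv) hs ht hst
  simp only [smul_eq_mul] at h1
  have h2 : 0 < Real.log 2 := Real.log_pos (by norm_num)
  unfold Real.logb
  rw [← mul_div_assoc, ← mul_div_assoc, ← add_div]
  gcongr

theorem stmt_15 (M N K L : ℕ) (hM : 0 < M) (hN : 0 < N) (hK : 0 < K) (hL : 0 < L)
    (a b : Fin K → Fin L → Fin N → ℝ) (h : ℝ) (hh : 0 < h) (A : ℝ) (hA : 0 < A)
    (D : Fin M → Fin N → ℝ)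
    (ct : Fin K → Fin L → Fin M → Fin N → ℝ) (hct : ∀ k l m n, 0 < ct k l m n) :
    Convex ℝ {p : (Fin M → Fin N → ℝ) × (Fin M → Fin N → ℝ) ×
        (Fin K → Fin L → Fin M → Fin N → ℝ) × ℝ |
      (∀ k l, (1 / ((N : ℝ) * L)) *
          ∑ n : Fin N, Real.logb 2 (1 + A * ∑ m : Fin M, p.2.2.1 k l m n) ≥ p.2.2.2) ∧
      (∀ k l m n, 0 ≤ p.2.2.1 k l m n) ∧
      (∀ k l m n, (p.1 m n - a k l n) ^ 2 + (p.2.1 m n - b k l n) ^ 2 + h ^ 2 ≤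
          1 / ct k l m n - (p.2.2.1 k l m n - ct k l m n) / (ct k l m n) ^ 2) ∧
      (∀ m : Fin M, ∀ n : ℕ, ∀ hn : n + 1 < N,
          (p.1 m ⟨n + 1, hn⟩ - p.1 m ⟨n, Nat.lt_of_succ_lt hn⟩) ^ 2 +
            (p.2.1 m ⟨n + 1, hn⟩ - p.2.1 m ⟨n, Nat.lt_of_succ_lt hn⟩) ^ 2 ≤
            (D m ⟨n, Nat.lt_of_succ_lt hn⟩) ^ 2)} := by
  rintro ⟨x, y, c, R⟩ ⟨p1, p2, p3, p4⟩ ⟨x', y', c', R'⟩ ⟨q1, q2, q3, q4⟩ s t hs ht hst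
  simp only at p1 p2 p3 p4 q1 q2 q3 q4
  refine ⟨?_, ?_, ?_, ?_⟩
  · intro k l
    simp only [Prod.smul_mk, Prod.mk_add_mk, Pi.add_apply, Pi.smul_apply, smul_eq_mul]
    have key : s * ∑ n : Fin N, Real.logb 2 (1 + A * ∑ m : Fin M, c k l m n)
        + t * ∑ n : Fin N, Real.logb 2 (1 + A * ∑ m : Fin M, c' k l m n)
        ≤ ∑ n : Fin N, Real.logb 2 (1 + A * ∑ m : Fin M, (s * c k l m n + t * c' k l m n)) := by
      rw [Finset.mul_sum, Finset.mul_sum, ← Finset.sum_add_distrib]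
      refine Finset.sum_le_sum fun n _ => ?_
      have hu : 0 ≤ A * ∑ m : Fin M, c k l m n :=
        mul_nonneg hA.le (Finset.sum_nonneg fun m _ => p2 k l m n)
      have hv : 0 ≤ A * ∑ m : Fin M, c' k l m n :=
        mul_nonneg hA.le (Finset.sum_nonneg fun m _ => q2 k l m n)
      refine (aux_log s t _ _ hs ht hst (by linarith) (by linarith)).trans (le_of_eq ?_)
      congr 1
      rw [Finset.sum_add_distrib, ← Finset.mul_sum, ← Finset.mul_sum]
      linear_combination hst
    have hc : 0 ≤ 1 / ((N : ℝ) * L) := by positivity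
    have h1 := mul_le_mul_of_nonneg_left key hc
    have h2 := mul_le_mul_of_nonneg_left (p1 k l) hs
    have h3 := mul_le_mul_of_nonneg_left (q1 k l) ht
    linarith
  · intro k l m n
    exact add_nonneg (mul_nonneg hs (p2 k l m n)) (mul_nonneg ht (q2 k l m n))
  · intro k l m n
    simp only [Prod.smul_mk, Prod.mk_add_mk, Pi.add_apply, Pi.smul_apply, smul_eq_mul]
    have h2 := mul_le_mul_of_nonneg_left (p3 k l m n) hs
    have h3 := mul_le_mul_of_nonneg_left (q3 k l m n) ht
    have h4 := aux_sq s t (x m n - a k l n) (x' m n - a k l n) hs ht hst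
    have h5 := aux_sq s t (y m n - b k l n) (y' m n - b k l n) hs ht hst
    have ht' : t = 1 - s := by linarith
    subst ht'
    ring_nf at h2 h3 h4 h5 ⊢
    linarith
  · intro m n hn
    simp only [Prod.smul_mk, Prod.mk_add_mk, Pi.add_apply, Pi.smul_apply, smul_eq_mul]
    have h2 := mul_le_mul_of_nonneg_left (p4 m n hn) hs
    have h3 := mul_le_mul_of_nonneg_left (q4 m n hn) ht
    have h4 := aux_sq s t (x m ⟨n + 1, hn⟩ - x m ⟨n, Nat.lt_of_succ_lt hn⟩)
      (x' m ⟨n + 1, hn⟩ - x' m ⟨n, Nat.lt_of_succ_lt hn⟩) hs ht hst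
    have h5 := aux_sq s t (y m ⟨n + 1, hn⟩ - y m ⟨n, Nat.lt_of_succ_lt hn⟩)
      (y' m ⟨n + 1, hn⟩ - y' m ⟨n, Nat.lt_of_succ_lt hn⟩) hs ht hst
    have ht' : t = 1 - s := by linarith
    subst ht'
    linarith
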